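/- The subalgebra Q[x_{n-1}] of the group algebra Q[S_{n+1}] generated by x_{n-1} (the sum of all w with w(1)<...<w(n)) is isomorphic as a Q-algebra to Q[x]/(x^(falling (n+1)) - x^(falling n)), via the map sending x to x_{n-1}. -/

import Mathlib

/-- In the group algebra `ℚ[S_N]` (permutations of `{0, 1, ..., N-1}`, corresponding to
`{1, ..., N}` in one-based indexing), `xA N j` is the sum of all permutations `w` with
`w 0 < w 1 < ... < w j`, i.e. the minimal-length left coset representatives of the
parabolic subgroup generated by the adjacent transpositions `s_1, ..., s_j`. -/
noncomputable def xA (N j : ℕ) : MonoidAlgebra ℚ (Equiv.Perm (Fin N)) :=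
  ∑ w ∈ Finset.univ.filter
      (fun w : Equiv.Perm (Fin N) => ∀ a b : Fin N, a < b → (b : ℕ) ≤ j → w a < w b),
    MonoidAlgebra.single w 1

open Polynomial

/-- `w` is increasing on the positions `0, ..., n - k`, that is, on all but the last `k`. -/
def IncreasingButLast {n : ℕ} (k : ℕ) (w : Equiv.Perm (Fin (n + 1))) : Prop :=
  ∀ a b : Fin (n + 1), a < b → (b : ℕ) + k ≤ n → w a < w b

namespace IncreasingButLast

variable {n k l : ℕ} {w : Equiv.Perm (Fin (n + 1))}

theorem mono (hkl : k ≤ l) (h : IncreasingButLast k w) : IncreasingButLast l w :=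
  fun a b hab hb => h a b hab (by omega)

theorem of_le (hk : n ≤ k) : IncreasingButLast k w := by
  intro a b hab hb
  have : (a : ℕ) < b := hab
  omega

theorem zero_iff : IncreasingButLast 0 w ↔ w = 1 := by
  constructor
  · intro h
    have hw : StrictMono w := fun a b hab => h a b hab (by omega)
    ext a
    have := congrFun ((hw.range_inj (strictMono_id (α := Fin (n + 1)))).1 (by simp)) a
    simp [this]
  · rintro rfl a b hab -
    simpa using hab

/-- The swap of positions `n - k - 1` and `n - k` is increasing on all but the last `k + 1`
positions and no fewer. -/
theorem exists_not_of_lt (hk : k < n) :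
    ∃ w : Equiv.Perm (Fin (n + 1)), IncreasingButLast (k + 1) w ∧ ¬ IncreasingButLast k w := by
  let p : Fin (n + 1) := ⟨n - k - 1, by omega⟩
  let q : Fin (n + 1) := ⟨n - k, by omega⟩
  have hpq : p < q := by simp only [p, q, Fin.mk_lt_mk]; omega
  refine ⟨Equiv.swap p q, fun a b hab hb => ?_, fun h => ?_⟩
  · have hab' : (a : ℕ) < b := hab
    have haq : a ≠ q := by rintro rfl; simp only [q] at hab'; omega
    have hbq : b ≠ q := by rintro rfl; simp only [q] at hb; omega
    have hap : a ≠ p := by rintro rfl; simp only [p] at hab'; omega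
    rw [Equiv.swap_apply_of_ne_of_ne hap haq]
    rcases eq_or_ne b p with rfl | hbp
    · rw [Equiv.swap_apply_left]
      exact hab.trans hpq
    · rwa [Equiv.swap_apply_of_ne_of_ne hbp hbq]
  · have := h p q hpq (by simp only [q]; omega)
    rw [Equiv.swap_apply_left, Equiv.swap_apply_right] at this
    exact lt_asymm this hpq

end IncreasingButLast

/-- The permutation sending the last point to `j` and increasing on the other points. -/
def insertLast {n : ℕ} (j : Fin (n + 1)) : Equiv.Perm (Fin (n + 1)) :=
  finSuccEquivLast.trans (finSuccEquiv' j).symm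

section insertLast

variable {n : ℕ}

@[simp]
theorem insertLast_last (j : Fin (n + 1)) : insertLast j (Fin.last n) = j := by
  simp [insertLast]

@[simp]
theorem insertLast_castSucc (j : Fin (n + 1)) (i : Fin n) :
    insertLast j i.castSucc = j.succAbove i := by
  simp [insertLast]

theorem insertLast_injective : Function.Injective (insertLast (n := n)) := fun i j h => by
  simpa using congrArg (· (Fin.last n)) h

theorem increasingButLast_one_iff {w : Equiv.Perm (Fin (n + 1))} :
    IncreasingButLast 1 w ↔ ∃ j, insertLast j = w := by
  constructor
  · intro h
    refine ⟨w (Fin.last n), ?_⟩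
    have hw : StrictMono fun i : Fin n => w i.castSucc := fun a b hab =>
      h _ _ (Fin.castSucc_lt_castSucc_iff.2 hab) (by simp)
    have hrange : Set.range (fun i : Fin n => w i.castSucc) =
        Set.range (w (Fin.last n)).succAbove := by
      rw [Fin.range_succAbove, ← Set.image_singleton, ← Set.image_compl_eq w.bijective,
        ← Fin.range_succAbove, ← Set.range_comp, Fin.succAbove_last]
      rfl
    have := (hw.range_inj (Fin.strictMono_succAbove _)).1 hrange
    ext x
    induction x using Fin.lastCases with
    | last => simp
    | cast i => simp [← congrFun this i]
  · rintro ⟨j, rfl⟩ a b hab hb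
    induction a using Fin.lastCases with
    | last => exact absurd (Fin.le_last b) hab.not_ge
    | cast a =>
      induction b using Fin.lastCases with
      | last => simp at hb
      | cast b => simpa using hab

theorem insertLast_inv_lt_iff (j x y : Fin (n + 1)) (hxy : x ≠ y) :
    (insertLast j)⁻¹ x < (insertLast j)⁻¹ y ↔ x ≠ j ∧ (y = j ∨ x < y) := by
  obtain ⟨x, rfl⟩ := (insertLast j).surjective x
  obtain ⟨y, rfl⟩ := (insertLast j).surjective y
  simp only [Equiv.Perm.inv_def, Equiv.symm_apply_apply]
  induction x using Fin.lastCases with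
  | last => simp [Fin.le_last]
  | cast x =>
    induction y using Fin.lastCases with
    | last => simp [Fin.castSucc_lt_last]
    | cast y => simp

theorem increasingButLast_insertLast_inv_mul_iff {k : ℕ} (v : Equiv.Perm (Fin (n + 1)))
    (p : Fin (n + 1)) :
    IncreasingButLast k ((insertLast (v p))⁻¹ * v) ↔
      (n < p + k ∧ IncreasingButLast k v) ∨ ((p : ℕ) + k = n ∧ IncreasingButLast (k + 1) v) := by
  have key : IncreasingButLast k ((insertLast (v p))⁻¹ * v) ↔
      ∀ a b : Fin (n + 1), a < b → (b : ℕ) + k ≤ n → a ≠ p ∧ (b = p ∨ v a < v b) := by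
    refine forall₄_congr fun a b hab hb => ?_
    rw [Equiv.Perm.mul_apply, Equiv.Perm.mul_apply,
      insertLast_inv_lt_iff _ _ _ (v.injective.ne hab.ne)]
    simp
  rw [key]
  rcases lt_trichotomy n (p + k) with h | h | h
  · have : ∀ a b : Fin (n + 1), a < b → (b : ℕ) + k ≤ n → a ≠ p ∧ b ≠ p := by
      intro a b hab hb
      have : (a : ℕ) < b := hab
      constructor <;> rintro rfl <;> omega
    simp only [h, h.ne', true_and, false_and, or_false]
    refine forall₄_congr fun a b hab hb => ?_
    simp [this a b hab hb]
  · simp only [← h, lt_irrefl, true_and, false_and, false_or]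
    constructor
    · intro H a b hab hb
      rcases H a b hab (by omega) with ⟨-, rfl | H⟩
      · omega
      · exact H
    · intro H a b hab hb
      have hab' : (a : ℕ) < b := hab
      refine ⟨by rintro rfl; omega, ?_⟩
      rw [or_iff_not_imp_left]
      intro hbp
      have : (b : ℕ) ≠ p := Fin.val_ne_of_ne hbp
      exact H a b hab (by omega)
  · simp only [h.not_gt, h.ne, false_and, or_false, iff_false]
    intro H
    have := (H p ⟨p + 1, by omega⟩ (by simp [Fin.lt_def]) (by simp only; omega)).1
    exact this rfl

end insertLast

open scoped Classical in
/-- The sum of all permutations that are increasing on all but the last `k` positions. -/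
noncomputable def sumIncreasingButLast (n k : ℕ) : MonoidAlgebra ℚ (Equiv.Perm (Fin (n + 1))) :=
  ∑ w : Equiv.Perm (Fin (n + 1)) with IncreasingButLast k w, MonoidAlgebra.single w 1

open scoped Classical in
theorem coeff_sumIncreasingButLast (n k : ℕ) (v : Equiv.Perm (Fin (n + 1))) :
    (sumIncreasingButLast n k).coeff v = if IncreasingButLast k v then 1 else 0 := by
  simp [sumIncreasingButLast, MonoidAlgebra.coeff_sum, Finsupp.finsetSum_apply,
    Finsupp.single_apply]

theorem sumIncreasingButLast_zero (n : ℕ) : sumIncreasingButLast n 0 = 1 := by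
  classical
  ext v
  simp [coeff_sumIncreasingButLast, IncreasingButLast.zero_iff, MonoidAlgebra.one_def,
    Finsupp.single_apply, eq_comm]

theorem sumIncreasingButLast_of_le {n k : ℕ} (h : n ≤ k) :
    sumIncreasingButLast n k = sumIncreasingButLast n n := by
  classical
  ext v
  simp [coeff_sumIncreasingButLast, IncreasingButLast.of_le h, IncreasingButLast.of_le le_rfl]

theorem sumIncreasingButLast_one (n : ℕ) :
    sumIncreasingButLast n 1 = ∑ j, MonoidAlgebra.single (insertLast j) 1 := by
  classical
  rw [sumIncreasingButLast, ← Finset.sum_image (s := Finset.univ) (g := insertLast)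
    (f := fun w => MonoidAlgebra.single w (1 : ℚ)) insertLast_injective.injOn]
  congr 1
  ext w
  simp [increasingButLast_one_iff]

theorem sumIncreasingButLast_one_mul {n k : ℕ} (hk : k ≤ n) :
    sumIncreasingButLast n 1 * sumIncreasingButLast n k =
      (k : ℚ) • sumIncreasingButLast n k + sumIncreasingButLast n (k + 1) := by
  classical
  ext v
  have hlast : ∑ p : Fin (n + 1), (if n < p + k then (1 : ℚ) else 0) = k := by
    rw [Fin.sum_univ_eq_sum_range (fun p => if n < p + k then (1 : ℚ) else 0), Finset.sum_boole]
    have : (Finset.range (n + 1)).filter (fun p => n < p + k) = Finset.Ico (n + 1 - k) (n + 1) := by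
      ext p
      simp only [Finset.mem_filter, Finset.mem_range, Finset.mem_Ico]
      omega
    rw [this, Nat.card_Ico]
    congr 1
    omega
  have hmid : ∑ p : Fin (n + 1), (if (p : ℕ) + k = n then (1 : ℚ) else 0) = 1 := by
    rw [Finset.sum_eq_single (⟨n - k, by omega⟩ : Fin (n + 1))]
    · simp [hk]
    · intro p _ hp
      have : (p : ℕ) ≠ n - k := fun h => hp (Fin.ext h)
      rw [if_neg (by omega)]
    · simp
  have hterm (p : Fin (n + 1)) :
      (if IncreasingButLast k ((insertLast (v p))⁻¹ * v) then (1 : ℚ) else 0) =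
        (if n < p + k then (1 : ℚ) else 0) * (if IncreasingButLast k v then 1 else 0) +
        (if (p : ℕ) + k = n then (1 : ℚ) else 0) * (if IncreasingButLast (k + 1) v then 1 else 0) := by
    simp only [increasingButLast_insertLast_inv_mul_iff]
    by_cases h₁ : n < p + k
    · simp [h₁, h₁.ne']
    · simp [h₁]
      grind
  rw [sumIncreasingButLast_one, Finset.sum_mul, MonoidAlgebra.coeff_sum, Finsupp.finsetSum_apply]
  simp only [MonoidAlgebra.coeff_single_mul_apply, one_mul, coeff_sumIncreasingButLast]
  rw [← Equiv.sum_comp v]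
  simp only [hterm, Finset.sum_add_distrib, ← Finset.sum_mul, hlast, hmid]
  simp [coeff_sumIncreasingButLast]

theorem aeval_descPochhammer_sumIncreasingButLast {n k : ℕ} (hk : k ≤ n + 1) :
    aeval (sumIncreasingButLast n 1) (descPochhammer ℚ k) = sumIncreasingButLast n k := by
  induction k with
  | zero => simp [sumIncreasingButLast_zero]
  | succ k ih =>
    rw [descPochhammer_succ_right, mul_comm, map_mul, ih (by omega), map_sub, aeval_X, sub_mul,
      sumIncreasingButLast_one_mul (by omega)]
    simp [Nat.cast_smul_eq_nsmul, ← nsmul_eq_mul]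

theorem degree_descPochhammer (k : ℕ) : (descPochhammer ℚ k).degree = k := by
  rw [degree_eq_natDegree (monic_descPochhammer ℚ k).ne_zero, descPochhammer_natDegree]

/-- Polynomials of degree at most `d` in the sum of the permutations that are increasing on all but
the last position are supported on permutations that are increasing on all but the last `d`. -/
theorem coeff_aeval_eq_zero_of_degree_le {n d : ℕ} (hd : d ≤ n) {q : ℚ[X]} (hq : q.degree ≤ d)
    {v : Equiv.Perm (Fin (n + 1))} (hv : ¬ IncreasingButLast d v) :
    (aeval (sumIncreasingButLast n 1) q).coeff v = 0 := by
  classical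
  induction d generalizing q with
  | zero =>
    rw [eq_C_of_degree_le_zero hq]
    rw [IncreasingButLast.zero_iff] at hv
    simp [Algebra.algebraMap_eq_smul_one, MonoidAlgebra.one_def, Ne.symm hv]
  | succ d ih =>
    have hdeg : (q - C (q.coeff (d + 1)) * descPochhammer ℚ (d + 1)).degree ≤ d := by
      rw [degree_le_iff_coeff_zero] at hq ⊢
      intro m hm
      have hm : d < m := by exact_mod_cast hm
      rcases eq_or_lt_of_le (Nat.succ_le_of_lt hm) with rfl | hm'
      · have := (monic_descPochhammer ℚ (d + 1)).coeff_natDegree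
        rw [descPochhammer_natDegree] at this
        simp [this]
      · rw [coeff_sub, coeff_C_mul, hq m (by exact_mod_cast hm'),
          coeff_eq_zero_of_natDegree_lt (p := descPochhammer ℚ (d + 1))
            (by rwa [descPochhammer_natDegree])]
        simp
    have := ih (by omega) hdeg (fun h => hv (h.mono (by omega)))
    rw [map_sub, map_mul, aeval_C, ← Algebra.smul_def,
      aeval_descPochhammer_sumIncreasingButLast (by omega)] at this
    simpa [coeff_sumIncreasingButLast, hv] using this

theorem aeval_sumIncreasingButLast_ne_zero {n : ℕ} {q : ℚ[X]} (hq : q.Monic)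
    (hqn : q.natDegree ≤ n) : aeval (sumIncreasingButLast n 1) q ≠ 0 := by
  classical
  intro h0
  rcases hd : q.natDegree with _ | d
  · rw [eq_one_of_monic_natDegree_zero hq hd] at h0
    simp at h0
  · obtain ⟨v, hv, hv'⟩ := IncreasingButLast.exists_not_of_lt (n := n) (k := d) (by omega)
    have hdeg : (q - descPochhammer ℚ (d + 1)).degree ≤ d := by
      have hq' : q.degree = (d + 1 : ℕ) := by rw [degree_eq_natDegree hq.ne_zero, hd]
      have := degree_sub_lt_left (hq'.trans (degree_descPochhammer _).symm) hq.ne_zero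
        (hq.leadingCoeff.trans (monic_descPochhammer ℚ _).leadingCoeff.symm)
      rw [hq', degree_lt_iff_coeff_zero] at this
      rw [degree_le_iff_coeff_zero]
      exact fun m hm => this m (by exact_mod_cast hm)
    have := coeff_aeval_eq_zero_of_degree_le (by omega) hdeg hv'
    rw [map_sub, h0, aeval_descPochhammer_sumIncreasingButLast (by omega)] at this
    simp [coeff_sumIncreasingButLast, hv] at this

theorem minpoly_sumIncreasingButLast (n : ℕ) :
    minpoly ℚ (sumIncreasingButLast n 1) = descPochhammer ℚ (n + 1) - descPochhammer ℚ n := by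
  have hlt : (descPochhammer ℚ n).degree < (descPochhammer ℚ (n + 1)).degree := by
    rw [degree_descPochhammer, degree_descPochhammer]
    exact_mod_cast n.lt_succ_self
  refine (minpoly.unique _ _ ((monic_descPochhammer ℚ _).sub_of_left hlt) ?_ ?_).symm
  · rw [map_sub, aeval_descPochhammer_sumIncreasingButLast le_rfl,
      aeval_descPochhammer_sumIncreasingButLast n.le_succ, sumIncreasingButLast_of_le n.le_succ,
      sub_self]
  · intro q hq hq0
    rw [degree_sub_eq_left_of_degree_lt hlt, degree_descPochhammer,
      degree_eq_natDegree hq.ne_zero, Nat.cast_le]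
    by_contra! h
    exact aeval_sumIncreasingButLast_ne_zero hq (by omega) hq0

theorem xA_eq_sumIncreasingButLast {n : ℕ} (hn : 1 ≤ n) :
    xA (n + 1) (n - 1) = sumIncreasingButLast n 1 := by
  classical
  rw [xA, sumIncreasingButLast]
  congr 1
  ext w
  simp only [Finset.mem_filter, Finset.mem_univ, true_and]
  refine forall₃_congr fun a b hab => ?_
  rw [Nat.le_sub_iff_add_le hn]

open Polynomial in
/-- The subalgebra `ℚ[x_{n-1}]` of `ℚ[S_{n+1}]` generated by `x_{n-1}` is isomorphic
as a `ℚ`-algebra to `ℚ[x]/(x^(falling (n+1)) - x^(falling n))`, via the map sending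
(the coset of) `x` to `x_{n-1}`. -/
theorem adjoin_xA_equiv (n : ℕ) (hn : 1 ≤ n) :
    ∃ e : (ℚ[X] ⧸ Ideal.span {descPochhammer ℚ (n + 1) - descPochhammer ℚ n}) ≃ₐ[ℚ]
        Algebra.adjoin ℚ {xA (n + 1) (n - 1)},
      (e (Ideal.Quotient.mk _ X) : MonoidAlgebra ℚ (Equiv.Perm (Fin (n + 1)))) =
        xA (n + 1) (n - 1) := by
  rw [xA_eq_sumIncreasingButLast hn]
  set x := sumIncreasingButLast n 1 with hx
  have hker : Ideal.span {descPochhammer ℚ (n + 1) - descPochhammer ℚ n} =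
      RingHom.ker (aeval (R := ℚ) x).rangeRestrict := by
    rw [AlgHom.ker_rangeRestrict, minpoly.ker_aeval_eq_span_minpoly, hx,
      minpoly_sumIncreasingButLast]
  refine ⟨((Ideal.quotientEquivAlgOfEq ℚ hker).trans
    (Ideal.quotientKerAlgEquivOfSurjective (aeval (R := ℚ) x).rangeRestrict_surjective)).trans
    (Subalgebra.equivOfEq _ _ (Algebra.adjoin_singleton_eq_range_aeval ℚ x).symm), ?_⟩
  simp
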